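/- arXiv:2108.08276 — 6 statements merged into one kernel-verified Lean document; each statement's English description precedes it below -/
import Mathlib

section
/- Let X be a θ-↕-closed topologized semilattice. Then for every chain C ⊆ X the θ-closure cl_θ(C) is a chain. -/
open Set

/-- The θ-closure of a set in a topological space. -/
def thetaCl {X : Type*} [TopologicalSpace X] (A : Set X) : Set X :=
  {x | ∀ U : Set X, IsOpen U → x ∈ U → (closure U ∩ A).Nonempty}

/-- In a θ-↕-closed topologized semilattice the θ-closure of a chain is
a chain. -/
theorem thetaCl_chain_of_updown_closed {X : Type*} [SemilatticeInf X] [TopologicalSpace X]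
    (hud : ∀ x : X, thetaCl {y : X | y ≤ x ∨ x ≤ y} = {y : X | y ≤ x ∨ x ≤ y})
    (C : Set X) (hC : IsChain (· ≤ ·) C) :
    IsChain (· ≤ ·) (thetaCl C) := by
  have mono : ∀ A B : Set X, A ⊆ B → thetaCl A ⊆ thetaCl B := by
    intro A B h x hx U hU hxU
    obtain ⟨y, hy, hyA⟩ := hx U hU hxU
    exact ⟨y, hy, h hyA⟩
  have h1 : ∀ x : X, (∀ c ∈ C, c ≤ x ∨ x ≤ c) → ∀ y ∈ thetaCl C, y ≤ x ∨ x ≤ y := by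
    intro x hx y hy
    have h2 := mono C {y : X | y ≤ x ∨ x ≤ y} hx hy
    rw [hud x] at h2
    exact h2
  intro x hx y hy _
  refine (h1 x ?_ y hy).symm
  intro c hc
  exact (h1 c (fun d hd => hC.total hd hc) x hx).symm
end

section
/- Let X be a θ-complete, θ-↑↓-closed topologized semilattice and C ⊆ X a chain. Then cl_θ(C) is a θ-closed set, i.e., cl_θ(cl_θ(C)) = cl_θ(C). -/
open Set

theorem aux_mono {X : Type*} [TopologicalSpace X] {A B : Set X} (h : A ⊆ B) :
    thetaCl A ⊆ thetaCl B := fun x hx U hU hxU => (hx U hU hxU).mono (by gcongr)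

theorem aux_sub {X : Type*} [TopologicalSpace X] (A : Set X) : A ⊆ thetaCl A :=
  fun x hx U _ hxU => ⟨x, subset_closure hxU, hx⟩

theorem aux_union {X : Type*} [TopologicalSpace X] {A B C : Set X} (h : C ⊆ A ∪ B) {x : X}
    (hx : x ∈ thetaCl C) : x ∈ thetaCl A ∨ x ∈ thetaCl B := by
  by_contra hcon
  push Not at hcon
  obtain ⟨h1, h2⟩ := hcon
  simp only [thetaCl, mem_setOf_eq, not_forall] at h1 h2
  obtain ⟨U, hU, hxU, hUA⟩ := h1
  obtain ⟨V, hV, hxV, hVB⟩ := h2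
  obtain ⟨z, hz, hzC⟩ := hx (U ∩ V) (hU.inter hV) ⟨hxU, hxV⟩
  rcases h hzC with hz' | hz'
  · exact hUA ⟨z, closure_mono inter_subset_left hz, hz'⟩
  · exact hVB ⟨z, closure_mono inter_subset_right hz, hz'⟩

theorem aux_nonempty {X : Type*} [TopologicalSpace X] {A : Set X} {x : X}
    (hx : x ∈ thetaCl A) : A.Nonempty := by
  obtain ⟨z, _, hz⟩ := hx univ isOpen_univ trivial
  exact ⟨z, hz⟩

theorem aux_step {P : Type*} [PartialOrder P] (C D : Set P) (y : P)
    (hcl : ∀ d ∈ D, IsLUB (C ∩ {z | z ≤ d}) d ∨ IsGLB (C ∩ {z | d ≤ z}) d)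
    (hDC : ∀ d ∈ D, ∀ c ∈ C, d ≤ c ∨ c ≤ d)
    (hD : ∀ d ∈ D, ∀ e ∈ D, d ≤ e ∨ e ≤ d)
    (hy : IsLUB (D ∩ {z | z ≤ y}) y) (hyD : y ∉ D) :
    ∀ e ∈ D ∩ {z | z ≤ y}, ∃ c ∈ C ∩ {z | z ≤ y}, e ≤ c := by
  have nxt : ∀ e ∈ D ∩ {z | z ≤ y}, ∃ e' ∈ D ∩ {z | z ≤ y}, e ≤ e' ∧ ¬ e' ≤ e := by
    intro e he
    by_contra hcon
    push Not at hcon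
    have : y ≤ e := hy.2 fun e' he' => by
      rcases hD e he.1 e' he'.1 with h | h
      · exact hcon e' he' h
      · exact h
    exact hyD (le_antisymm this he.2 ▸ he.1)
  intro e he
  obtain ⟨e', he', h1, h2⟩ := nxt e he
  obtain ⟨f, hf, h3, h4⟩ := nxt e' he'
  rcases hcl e' he'.1 with h | h
  · by_contra hcon
    push Not at hcon
    refine h2 (h.2 fun c hc => ?_)
    rcases hDC e he.1 c hc.1 with h' | h'
    · exact absurd h' (hcon c ⟨hc.1, le_trans hc.2 he'.2⟩)
    · exact h'
  · by_contra hcon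
    push Not at hcon
    refine h4 (h.2 fun c hc => ?_)
    rcases hDC f hf.1 c hc.1 with h' | h'
    · exact h'
    · exact absurd (le_trans h1 hc.2) (hcon c ⟨hc.1, le_trans h' hf.2⟩)

/-- In a θ-complete, θ-↑↓-closed topologized semilattice the θ-closure
of any chain is θ-closed. -/
theorem thetaCl_chain_theta_closed {X : Type*} [SemilatticeInf X] [TopologicalSpace X]
    (hθ : ∀ C : Set X, C.Nonempty → IsChain (· ≤ ·) C →
      ∃ a b : X, IsGLB C a ∧ IsLUB C b ∧ a ∈ thetaCl C ∧ b ∈ thetaCl C)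
    (hud : ∀ x : X, thetaCl {y : X | x ≤ y} = {y : X | x ≤ y} ∧
      thetaCl {y : X | y ≤ x} = {y : X | y ≤ x})
    (C : Set X) (hC : IsChain (· ≤ ·) C) :
    thetaCl (thetaCl C) = thetaCl C := by
  have up : ∀ (x : X) (A : Set X), (∀ a ∈ A, x ≤ a) → ∀ y ∈ thetaCl A, x ≤ y := by
    intro x A hA y hy
    have h := aux_mono (B := {y : X | x ≤ y}) hA hy
    rw [(hud x).1] at h
    exact h
  have dn : ∀ (x : X) (A : Set X), (∀ a ∈ A, a ≤ x) → ∀ y ∈ thetaCl A, y ≤ x := by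
    intro x A hA y hy
    have h := aux_mono (B := {y : X | y ≤ x}) hA hy
    rw [(hud x).2] at h
    exact h
  have cmp : ∀ (A : Set X) (x : X), (∀ a ∈ A, x ≤ a ∨ a ≤ x) →
      ∀ y ∈ thetaCl A, x ≤ y ∨ y ≤ x := by
    intro A x hA y hy
    rcases aux_union (A := {y : X | x ≤ y}) (B := {y : X | y ≤ x}) hA hy with h | h
    · exact Or.inl (up x _ (fun _ h => h) y h)
    · exact Or.inr (dn x _ (fun _ h => h) y h)
  have chain1 : ∀ A : Set X, IsChain (· ≤ ·) A → ∀ d ∈ thetaCl A, ∀ c ∈ A, d ≤ c ∨ c ≤ d :=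
    fun A hA d hd c hc => (cmp A c (fun a ha => hA.total hc ha) d hd).symm
  have chain2 : ∀ A : Set X, IsChain (· ≤ ·) A → ∀ d ∈ thetaCl A, ∀ e ∈ thetaCl A,
      d ≤ e ∨ e ≤ d :=
    fun A hA d hd e he => cmp A d (chain1 A hA d hd) e he
  have cls : ∀ A : Set X, IsChain (· ≤ ·) A → ∀ d ∈ thetaCl A,
      ((A ∩ {z | z ≤ d}).Nonempty ∧ IsLUB (A ∩ {z | z ≤ d}) d) ∨
      ((A ∩ {z | d ≤ z}).Nonempty ∧ IsGLB (A ∩ {z | d ≤ z}) d) := by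
    intro A hA d hd
    have hsub : A ⊆ (A ∩ {z | z ≤ d}) ∪ (A ∩ {z | d ≤ z}) := fun a ha => by
      rcases chain1 A hA d hd a ha with h | h
      · exact Or.inr ⟨ha, h⟩
      · exact Or.inl ⟨ha, h⟩
    rcases aux_union hsub hd with h | h
    · exact Or.inl ⟨aux_nonempty h, fun a ha => ha.2, fun b hb => dn b _ (fun a ha => hb ha) d h⟩
    · exact Or.inr ⟨aux_nonempty h, fun a ha => ha.2, fun b hb => up b _ (fun a ha => hb ha) d h⟩
  refine Subset.antisymm ?_ (aux_sub _)
  intro y hy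
  by_contra hyD
  have hD : IsChain (· ≤ ·) (thetaCl C) := fun d hd e he _ => chain2 C hC d hd e he
  have hcl := cls C hC
  rcases cls _ hD y hy with ⟨⟨e, he⟩, h⟩ | ⟨⟨e, he⟩, h⟩
  · have st := aux_step C (thetaCl C) y (fun d hd => (hcl d hd).imp And.right And.right)
      (chain1 C hC) (chain2 C hC) h hyD
    obtain ⟨c, hc, _⟩ := st e he
    obtain ⟨_, b, _, hb, _, hbC⟩ := hθ (C ∩ {z | z ≤ y}) ⟨c, hc⟩ (hC.mono inter_subset_left)
    have h1 : b ≤ y := hb.2 fun a ha => ha.2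
    have h2 : y ≤ b := h.2 fun e he => by
      obtain ⟨c, hc, hec⟩ := st e he
      exact hec.trans (hb.1 hc)
    exact hyD (le_antisymm h1 h2 ▸ aux_mono inter_subset_left hbC)
  · have st : ∀ e ∈ thetaCl C ∩ {z | y ≤ z}, ∃ c ∈ C ∩ {z | y ≤ z}, c ≤ e :=
      aux_step (P := Xᵒᵈ) C (thetaCl C) y
      (fun d hd => ((hcl d hd).imp And.right And.right).symm)
      (fun d hd c hc => (chain1 C hC d hd c hc).symm)
      (fun d hd c hc => (chain2 C hC d hd c hc).symm) h hyD
    obtain ⟨c, hc, _⟩ := st e he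
    obtain ⟨b, _, hb, _, hbC, _⟩ := hθ (C ∩ {z | y ≤ z}) ⟨c, hc⟩ (hC.mono inter_subset_left)
    have h1 : y ≤ b := hb.2 fun a ha => ha.2
    have h2 : b ≤ y := h.2 fun e he => by
      obtain ⟨c, hc, hec⟩ := st e he
      exact (hb.1 hc).trans hec
    exact hyD (le_antisymm h1 h2 ▸ aux_mono inter_subset_left hbC)
end

section
/- Let X be a θ-complete topologized semilattice. Then every θ-closed chain C ⊆ X is an H-set in X. -/
open Set

/-- A subset `M` of a topological space is an H-set if every cover of `M` by open sets
contains a finite subfamily whose closures cover `M`. -/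
def IsHSet {X : Type*} [TopologicalSpace X] (M : Set X) : Prop :=
  ∀ 𝒰 : Set (Set X), (∀ U ∈ 𝒰, IsOpen U) → M ⊆ ⋃₀ 𝒰 →
    ∃ ℱ ⊆ 𝒰, ℱ.Finite ∧ M ⊆ ⋃ U ∈ ℱ, closure U

/-- In a θ-complete topologized semilattice every θ-closed chain is an
H-set. -/
theorem theta_closed_chain_isHSet {X : Type*} [SemilatticeInf X] [TopologicalSpace X]
    (hθ : ∀ C : Set X, C.Nonempty → IsChain (· ≤ ·) C →
      ∃ a b : X, IsGLB C a ∧ IsLUB C b ∧ a ∈ thetaCl C ∧ b ∈ thetaCl C)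
    (C : Set X) (hC : IsChain (· ≤ ·) C) (hclosed : thetaCl C = C) :
    IsHSet C := by
  intro 𝒰 hop hcov
  have hsub : ∀ D ⊆ C, thetaCl D ⊆ C := by
    intro D hD x hx
    rw [← hclosed]
    intro U hU hxU
    exact (hx U hU hxU).mono (inter_subset_inter_right _ hD)
  let good : Set X → Prop := fun S => ∃ ℱ ⊆ 𝒰, ℱ.Finite ∧ S ⊆ ⋃ U ∈ ℱ, closure U
  have gmono : ∀ S T, S ⊆ T → good T → good S := by
    rintro S T h ⟨F, h1, h2, h3⟩
    exact ⟨F, h1, h2, h.trans h3⟩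
  have gunion : ∀ S T, good S → good T → good (S ∪ T) := by
    rintro S T ⟨F, h1, h2, h3⟩ ⟨G, k1, k2, k3⟩
    refine ⟨F ∪ G, union_subset h1 k1, h2.union k2, ?_⟩
    rw [biUnion_union]
    exact union_subset_union h3 k3
  have gcl : ∀ U ∈ 𝒰, good (closure U) := by
    intro U hU
    exact ⟨{U}, by simpa using hU, finite_singleton U, by simp⟩
  have gpt : ∀ x ∈ C, good {x} := by
    intro x hx
    obtain ⟨U, hU, hxU⟩ := hcov hx
    exact gmono _ _ (by simpa using subset_closure hxU) (gcl U hU)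
  have tot : ∀ x ∈ C, ∀ y ∈ C, x ≤ y ∨ y < x := by
    intro x hx y hy
    rcases hC.total hx hy with h | h
    · exact Or.inl h
    · rcases h.eq_or_lt with h | h
      · exact Or.inl h.ge
      · exact Or.inr h
  have left : ∀ b ∈ C, ∀ U, IsOpen U → b ∈ U → (∀ x ∈ C, x < b → x ∈ closure U) ∨
      ∃ s ∈ C, s < b ∧ ∀ x ∈ C, s < x → x < b → x ∈ closure U := by
    intro b hb U hU hbU
    let S : Set X := {x | x ∈ C ∧ x < b ∧ x ∉ closure U}
    have hSC : S ⊆ C := fun x hx => hx.1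
    by_cases hS : S.Nonempty
    · right
      obtain ⟨_, s, _, hs, _, hst⟩ := hθ S hS (hC.mono hSC)
      refine ⟨s, hsub S hSC hst, lt_of_le_of_ne (hs.2 fun x hx => hx.2.1.le) ?_, ?_⟩
      · rintro rfl
        obtain ⟨x, hx, hx2⟩ := hst U hU hbU
        exact hx2.2.2 hx
      · intro x hx hsx hxb
        by_contra hn
        exact (hs.1 (show x ∈ S from ⟨hx, hxb, hn⟩)).not_gt hsx
    · left
      intro x hx hxb
      by_contra hn
      exact hS ⟨x, hx, hxb, hn⟩
  have right : ∀ b ∈ C, ∀ U, IsOpen U → b ∈ U → (∀ x ∈ C, b < x → x ∈ closure U) ∨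
      ∃ s ∈ C, b < s ∧ ∀ x ∈ C, b < x → x < s → x ∈ closure U := by
    intro b hb U hU hbU
    let S : Set X := {x | x ∈ C ∧ b < x ∧ x ∉ closure U}
    have hSC : S ⊆ C := fun x hx => hx.1
    by_cases hS : S.Nonempty
    · right
      obtain ⟨s, _, hs, _, hst, _⟩ := hθ S hS (hC.mono hSC)
      refine ⟨s, hsub S hSC hst, lt_of_le_of_ne (hs.2 fun x hx => hx.2.1.le) ?_, ?_⟩
      · rintro rfl
        obtain ⟨x, hx, hx2⟩ := hst U hU hbU
        exact hx2.2.2 hx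
      · intro x hx hbx hxs
        by_contra hn
        exact (hs.1 (show x ∈ S from ⟨hx, hbx, hn⟩)).not_gt hxs
    · left
      intro x hx hxb
      by_contra hn
      exact hS ⟨x, hx, hxb, hn⟩
  change good C
  rcases C.eq_empty_or_nonempty with hE | hne
  · exact ⟨∅, empty_subset _, finite_empty, by simp [hE]⟩
  let A : Set X := {x | x ∈ C ∧ good (C ∩ Iic x)}
  have hAC : A ⊆ C := fun x hx => hx.1
  have hA : A.Nonempty := by
    obtain ⟨m, _, hm, _, hmt, _⟩ := hθ C hne hC
    have hmC := hsub C Subset.rfl hmt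
    refine ⟨m, hmC, gmono _ _ ?_ (gpt m hmC)⟩
    rintro x ⟨hx, hxm⟩
    exact le_antisymm hxm (hm.1 hx)
  obtain ⟨_, b, _, hb, _, hbt⟩ := hθ A hA (hC.mono hAC)
  have hbC := hsub A hAC hbt
  obtain ⟨U, hU, hbU⟩ := hcov hbC
  have hbg : good (C ∩ Iic b) := by
    rcases left b hbC U (hop U hU) hbU with h | ⟨s, hs, hsb, h⟩
    · refine gmono _ _ ?_ (gcl U hU)
      rintro x ⟨hx, hxb⟩
      rcases (mem_Iic.1 hxb).eq_or_lt with rfl | h2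
      · exact subset_closure hbU
      · exact h x hx h2
    · have hsg : ∃ a ∈ A, s < a := by
        by_contra! hn
        refine (hb.2 (fun a ha => ?_)).not_gt hsb
        rcases tot a (hAC ha) s hs with h3 | h3
        · exact h3
        · exact absurd h3 (hn a ha)
      obtain ⟨a, ha, hsa⟩ := hsg
      refine gmono _ _ ?_ (gunion _ _ ha.2 (gcl U hU))
      rintro x ⟨hx, hxb⟩
      rcases tot x hx s hs with h3 | h3
      · exact Or.inl ⟨hx, h3.trans hsa.le⟩
      · right
        rcases (mem_Iic.1 hxb).eq_or_lt with rfl | h2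
        · exact subset_closure hbU
        · exact h x hx h3 h2
  rcases right b hbC U (hop U hU) hbU with h | ⟨s, hs, hbs, h⟩
  · refine gmono _ _ ?_ (gunion _ _ hbg (gcl U hU))
    intro x hx
    rcases tot x hx b hbC with h3 | h3
    · exact Or.inl ⟨hx, h3⟩
    · exact Or.inr (h x hx h3)
  · exfalso
    have hsA : s ∈ A := by
      refine ⟨hs, gmono _ _ ?_ (gunion _ _ (gunion _ _ hbg (gcl U hU)) (gpt s hs))⟩
      rintro x ⟨hx, hxs⟩
      rcases tot x hx b hbC with h3 | h3
      · exact Or.inl (Or.inl ⟨hx, h3⟩)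
      · rcases (mem_Iic.1 hxs).eq_or_lt with h2 | h2
        · exact Or.inr h2
        · exact Or.inl (Or.inr (h x hx h3 h2))
    exact (hb.1 hsA).not_gt hbs
end

section
/- Let X be a weak θ-chain•-compact, θ-↕-closed topologized semilattice. Then cl_θ(C) is an H-set for every chain C ⊆ X. -/
open Set TopologicalSpace

/-- In a weak θ-chain•-compact, θ-↕-closed topologized semilattice the
θ-closure of every chain is an H-set. -/
theorem HSet_of_weak_theta_chain_compact {X : Type*} [SemilatticeInf X]
    [t : TopologicalSpace X]
    (hcpt : @CompactSpace X (generateFrom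
      {U : Set X | ∃ C : Set X, IsChain (· ≤ ·) C ∧ U = (thetaCl C)ᶜ}))
    (hud : ∀ x : X, thetaCl {y : X | y ≤ x ∨ x ≤ y} = {y : X | y ≤ x ∨ x ≤ y}) :
    ∀ C : Set X, IsChain (· ≤ ·) C → IsHSet (thetaCl C) := by
  intro C hC 𝒰 hU hcov
  have hsub : ∀ A : Set X, A ⊆ thetaCl A := fun A x hx U _ hxU =>
    ⟨x, subset_closure hxU, hx⟩
  have hmono : ∀ A B : Set X, A ⊆ B → thetaCl A ⊆ thetaCl B := by
    intro A B h x hx U hUo hxU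
    obtain ⟨y, h1, h2⟩ := hx U hUo hxU
    exact ⟨y, h1, h h2⟩
  have h1 : ∀ c ∈ C, ∀ x ∈ thetaCl C, x ≤ c ∨ c ≤ x := by
    intro c hc x hx
    have : thetaCl C ⊆ {y : X | y ≤ c ∨ c ≤ y} := by
      rw [← hud c]
      exact hmono _ _ (fun y hy => hC.total hy hc)
    exact this hx
  have h2 : ∀ x ∈ thetaCl C, ∀ z ∈ thetaCl C, z ≤ x ∨ x ≤ z := by
    intro x hx z hz
    have : thetaCl C ⊆ {y : X | y ≤ x ∨ x ≤ y} := by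
      rw [← hud x]
      exact hmono _ _ (fun y hy => (h1 y hy x hx).symm)
    exact this hz
  have hopen : ∀ D : Set X, IsChain (· ≤ ·) D → @IsOpen X (generateFrom
      {U : Set X | ∃ C : Set X, IsChain (· ≤ ·) C ∧ U = (thetaCl C)ᶜ}) (thetaCl D)ᶜ :=
    fun D hD => isOpen_generateFrom_of_mem ⟨D, hD, rfl⟩
  have hM := @IsClosed.isCompact X (generateFrom
      {U : Set X | ∃ C : Set X, IsChain (· ≤ ·) C ∧ U = (thetaCl C)ᶜ}) (thetaCl C) hcpt
      ((@isOpen_compl_iff X _ (generateFrom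
      {U : Set X | ∃ C : Set X, IsChain (· ≤ ·) C ∧ U = (thetaCl C)ᶜ})).1 (hopen C hC))
  obtain ⟨F, hF⟩ := @IsCompact.elim_finite_subcover X (generateFrom
      {U : Set X | ∃ C : Set X, IsChain (· ≤ ·) C ∧ U = (thetaCl C)ᶜ}) _ _ hM
    (fun U : 𝒰 => (thetaCl (thetaCl C \ closure U.1))ᶜ)
    (fun U => hopen (thetaCl C \ closure U.1) (fun x hx y hy _ => (h2 y hy.1 x hx.1)))
    (by
      intro x hx
      obtain ⟨U, hU', hxU⟩ := hcov hx
      refine mem_iUnion.2 ⟨⟨U, hU'⟩, fun h => ?_⟩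
      obtain ⟨y, hy1, hy2⟩ := h U (hU U hU') hxU
      exact hy2.2 hy1)
  refine ⟨Subtype.val '' (F : Set 𝒰), by rintro _ ⟨U, _, rfl⟩; exact U.2,
    F.finite_toSet.image _, ?_⟩
  intro x hx
  obtain ⟨U, hUF, hxU⟩ := mem_iUnion₂.1 (hF hx)
  refine mem_iUnion₂.2 ⟨U.1, ⟨U, hUF, rfl⟩, ?_⟩
  by_contra h
  exact hxU (hsub _ ⟨hx, h⟩)
end

section
/- Let X be a Urysohn topological space and r : X → X a retraction (a continuous map with r ∘ r = r). Then the image r(X) is θ-closed in X. -/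
open Set

/-- The image of a retraction of a Urysohn space is θ-closed. -/
theorem retract_theta_closed {X : Type*} [TopologicalSpace X]
    (hU : ∀ x y : X, x ≠ y → ∃ U V : Set X, IsOpen U ∧ IsOpen V ∧ x ∈ U ∧ y ∈ V ∧
      closure U ∩ closure V = ∅)
    (r : X → X) (hr : Continuous r) (hrr : r ∘ r = r) :
    thetaCl (Set.range r) = Set.range r := by
  apply Set.Subset.antisymm
  · intro x hx
    by_contra hn
    have hne : x ≠ r x := fun h => hn ⟨x, h.symm⟩
    obtain ⟨U, V, hUo, hVo, hxU, hxV, hd⟩ := hU x (r x) hne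
    obtain ⟨z, hz, w, hw⟩ := hx (U ∩ r ⁻¹' V) (hUo.inter (hVo.preimage hr)) ⟨hxU, hxV⟩
    have hrz : r z = z := by
      rw [← hw]
      exact congrFun hrr w
    have h1 : z ∈ closure U := closure_mono Set.inter_subset_left hz
    have h2 : z ∈ closure (r ⁻¹' V) := closure_mono Set.inter_subset_right hz
    have h3 : r z ∈ closure V := hr.closure_preimage_subset V h2
    rw [hrz] at h3
    have h4 : z ∈ closure U ∩ closure V := ⟨h1, h3⟩
    rw [hd] at h4
    exact h4
  · intro x hx U _ hxU
    exact ⟨x, subset_closure hxU, hx⟩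
end

section
/- Every Urysohn semitopological semilattice X is θ-↑↓-closed: for each x ∈ X the sets ↑x = {y : x ≤ y} and ↓x = {y : y ≤ x} are θ-closed in X. -/
open Set

theorem thetaCl_eqLocus_aux {X : Type*} [TopologicalSpace X]
    (hU : ∀ x y : X, x ≠ y → ∃ U V : Set X, IsOpen U ∧ IsOpen V ∧ x ∈ U ∧ y ∈ V ∧
      closure U ∩ closure V = ∅) (f g : X → X) (hf : Continuous f) (hg : Continuous g) :
    thetaCl {y : X | f y = g y} = {y : X | f y = g y} := by
  apply Set.Subset.antisymm
  · intro y hy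
    by_contra hne
    obtain ⟨U, V, oU, oV, hyU, hyV, hd⟩ := hU (f y) (g y) hne
    obtain ⟨z, hz, hzz⟩ := hy (f ⁻¹' U ∩ g ⁻¹' V)
      ((oU.preimage hf).inter (oV.preimage hg)) ⟨hyU, hyV⟩
    have h1 : f z ∈ closure U :=
      hf.closure_preimage_subset U (closure_mono Set.inter_subset_left hz)
    have h2 : g z ∈ closure V :=
      hg.closure_preimage_subset V (closure_mono Set.inter_subset_right hz)
    have hzz' : f z = g z := hzz
    rw [← hzz'] at h2
    have h3 : f z ∈ closure U ∩ closure V := ⟨h1, h2⟩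
    rw [hd] at h3
    exact h3
  · intro y hy U _ hyU
    exact ⟨y, subset_closure hyU, hy⟩

/-- A Urysohn semitopological semilattice is θ-↑↓-closed. -/
theorem urysohn_semitopological_theta_updown_closed {X : Type*} [SemilatticeInf X]
    [TopologicalSpace X]
    (hU : ∀ x y : X, x ≠ y → ∃ U V : Set X, IsOpen U ∧ IsOpen V ∧ x ∈ U ∧ y ∈ V ∧
      closure U ∩ closure V = ∅)
    (hcont₁ : ∀ y : X, Continuous fun x : X => x ⊓ y)
    (hcont₂ : ∀ y : X, Continuous fun x : X => y ⊓ x) :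
    ∀ x : X, thetaCl {y : X | x ≤ y} = {y : X | x ≤ y} ∧
      thetaCl {y : X | y ≤ x} = {y : X | y ≤ x} := by
  intro x
  constructor
  · have h := thetaCl_eqLocus_aux hU (fun y => y ⊓ x) (fun _ => x) (hcont₁ x) continuous_const
    simpa only [inf_eq_right] using h
  · have h := thetaCl_eqLocus_aux hU (fun y => y ⊓ x) (fun y => y) (hcont₁ x) continuous_id
    simpa only [inf_eq_left] using h
end
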